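/- Assume α_1 > 0 and α_3 > 0. Then for every j ∈ {1,…,n}, the vector x_j with entries x_{j,k} = sin(j·π·k·h) for odd k and x_{j,k} = √(α_3/α_1)·sin(j·π·k·h) for even k, where h = 1/(n+1), satisfies P(α)·x_j = λ_j·x_j with λ_j = α_0 + 2·√(α_1·α_3)·cos(j·π·h) + 2·α_2·cos(2·j·π·h); that is, (λ_j, x_j) is an eigenpair of the non-symmetric, non-persymmetric pentadiagonal matrix P(α). -/

import Mathlib

open Real Matrix

/-- Summing a function supported at a single integer index over `Fin n`. -/
theorem sum_fin_ite_intCast_eq (n : ℕ) (m : ℤ) (g : ℤ → ℝ) :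
    ∑ c : Fin n, (if ((c : ℕ) : ℤ) = m then g (c : ℕ) else 0) =
      if 0 ≤ m ∧ m < n then g m else 0 := by
  split_ifs with hm
  · lift m to ℕ using hm.1
    have hlt : m < n := by exact_mod_cast hm.2
    rw [Finset.sum_eq_single (⟨m, hlt⟩ : Fin n)]
    · simp
    · intro b _ hb
      rw [if_neg]
      exact fun e => hb (Fin.ext (by exact_mod_cast e))
    · simp
  · refine Finset.sum_eq_zero fun c _ => if_neg ?_
    have := c.isLt
    omega

/-- The sine sequence `sin((k+1)t)`, rescaled by `s` at odd `k`. -/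
noncomputable def scaledSine (s t : ℝ) (k : ℤ) : ℝ :=
  (if k % 2 = 0 then 1 else s) * sin (((k : ℝ) + 1) * t)

theorem scaledSine_neg_one (s t : ℝ) : scaledSine s t (-1) = 0 := by
  simp [scaledSine]

theorem scaledSine_neg_two (s t : ℝ) : scaledSine s t (-2) = -scaledSine s t 0 := by
  norm_num [scaledSine]

theorem scaledSine_natCast {s t : ℝ} {n : ℕ} (ht : sin ((n + 1) * t) = 0) :
    scaledSine s t n = 0 := by
  simp [scaledSine, ht]

theorem scaledSine_add_two_add_sub_two (s t : ℝ) (k : ℤ) :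
    scaledSine s t (k + 2) + scaledSine s t (k - 2) = 2 * cos (2 * t) * scaledSine s t k := by
  have h₁ : (k + 2) % 2 = k % 2 := by omega
  have h₂ : (k - 2) % 2 = k % 2 := by omega
  simp only [scaledSine, h₁, h₂]
  push_cast
  rw [show ((k : ℝ) + 2 + 1) * t = (k + 1) * t + 2 * t by ring,
    show ((k : ℝ) - 2 + 1) * t = (k + 1) * t - 2 * t by ring, sin_add, sin_sub]
  ring

theorem scaledSine_natCast_add_one {s t : ℝ} {n : ℕ} (ht : sin ((n + 1) * t) = 0) :
    scaledSine s t (n + 1) = -scaledSine s t (n - 1) := by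
  have h₁ : ((n : ℤ) + 1) % 2 = ((n : ℤ) - 1) % 2 := by omega
  simp only [scaledSine, h₁]
  push_cast
  rw [show ((n : ℝ) + 1 + 1) * t = (n + 1) * t + t by ring,
    show ((n : ℝ) - 1 + 1) * t = (n + 1) * t - t by ring, sin_add, sin_sub, ht]
  ring

theorem mul_scaledSine_add_one_add_sub_one {a b : ℝ} (ha : 0 < a) (hb : 0 < b) (t : ℝ) (k : ℤ) :
    (if k % 2 = 0 then a else b) *
        (scaledSine √(b / a) t (k + 1) + scaledSine √(b / a) t (k - 1)) =
      2 * √(a * b) * cos t * scaledSine √(b / a) t k := by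
  have hsin : sin (((k : ℝ) + 1 + 1) * t) + sin (((k : ℝ) - 1 + 1) * t) =
      2 * cos t * sin ((k + 1) * t) := by
    rw [show ((k : ℝ) + 1 + 1) * t = (k + 1) * t + t by ring,
      show ((k : ℝ) - 1 + 1) * t = (k + 1) * t - t by ring, sin_add, sin_sub]
    ring
  have hab : a * √(b / a) = √(a * b) := by
    rw [← Real.sqrt_sq ha.le, ← Real.sqrt_mul (sq_nonneg a), Real.sqrt_sq ha.le]
    congr 1
    field_simp
  have hb' : √(a * b) * √(b / a) = b := by
    rw [← hab, mul_assoc, Real.mul_self_sqrt (by positivity)]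
    field_simp
  simp only [scaledSine]
  push_cast
  rcases Int.emod_two_eq_zero_or_one k with hk | hk
  · have h₁ : ¬ (k + 1) % 2 = 0 := by omega
    have h₂ : ¬ (k - 1) % 2 = 0 := by omega
    simp only [hk, h₁, h₂, if_true, if_false]
    rw [← mul_add, hsin, ← mul_assoc, hab]
    ring
  · have h₁ : (k + 1) % 2 = 0 := by omega
    have h₂ : (k - 1) % 2 = 0 := by omega
    simp only [hk, h₁, h₂, if_true, one_ne_zero, if_false]
    rw [← mul_add, hsin]
    linear_combination -2 * cos t * sin ((k + 1) * t) * hb'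

/-- Assume `α_1 > 0` and `α_3 > 0`. For every `j ∈ {1,…,n}`, the
vector `x_j` with entries `x_{j,k} = sin(j·π·k·h)` for odd `k` and
`x_{j,k} = √(α_3/α_1)·sin(j·π·k·h)` for even `k`, `h = 1/(n+1)`, is an eigenvector
of the non-symmetric, non-persymmetric pentadiagonal matrix `P(α)` with eigenvalue
`λ_j = α_0 + 2·√(α_1·α_3)·cos(j·π·h) + 2·α_2·cos(2·j·π·h)`.
Rows/columns of `P(α)` are 0-based; a 1-based index is odd iff its 0-based
counterpart is even. -/
theorem stmt11 (n : ℕ) (hn : 4 ≤ n) (α0 α1 α2 α3 : ℝ)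
    (hα1 : 0 < α1) (hα3 : 0 < α3)
    (h : ℝ) (hh : h = 1 / (n + 1))
    (P : Matrix (Fin n) (Fin n) ℝ)
    (hP : ∀ r c : Fin n, P r c =
      if (r : ℕ) = (c : ℕ) then
        (if (r : ℕ) = 0 ∨ (r : ℕ) = n - 1 then α0 - α2 else α0)
      else if (r : ℕ) + 1 = (c : ℕ) ∨ (c : ℕ) + 1 = (r : ℕ) then
        (if (r : ℕ) % 2 = 0 then α1 else α3)
      else if (r : ℕ) + 2 = (c : ℕ) ∨ (c : ℕ) + 2 = (r : ℕ) then α2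
      else 0)
    (x : ℕ → Fin n → ℝ)
    (hx : ∀ (j : ℕ) (k : Fin n), x j k =
      (if (k : ℕ) % 2 = 0 then 1 else Real.sqrt (α3 / α1)) *
        Real.sin (j * π * ((k : ℝ) + 1) * h))
    (lam : ℕ → ℝ)
    (hlam : ∀ j : ℕ, lam j = α0 + 2 * Real.sqrt (α1 * α3) * Real.cos (j * π * h)
      + 2 * α2 * Real.cos (2 * j * π * h)) :
    ∀ j : ℕ, 1 ≤ j → j ≤ n → P.mulVec (x j) = lam j • x j := by
  intro j _ _
  set t : ℝ := j * π * h with htdef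
  have ht : sin (((n : ℝ) + 1) * t) = 0 := by
    have : ((n : ℝ) + 1) * t = j * π := by
      rw [htdef, hh]
      field_simp
    rw [this, sin_nat_mul_pi]
  set g : ℤ → ℝ := scaledSine √(α3 / α1) t with hg
  have hxg : ∀ c : Fin n, x j c = g (c : ℕ) := by
    intro c
    have hpar : (((c : ℕ) : ℤ) % 2 = 0) ↔ ((c : ℕ) % 2 = 0) := by omega
    simp only [hx, hg, scaledSine, hpar, Int.cast_natCast]
    congr 2
    rw [htdef]
    ring
  ext r
  have hr := r.isLt
  set d : ℝ := if (r : ℕ) = 0 ∨ (r : ℕ) = n - 1 then α0 - α2 else α0 with hd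
  set e : ℝ := if ((r : ℕ) : ℤ) % 2 = 0 then α1 else α3 with he
  have hentry : ∀ c : Fin n, P r c * x j c =
      d * (if ((c : ℕ) : ℤ) = (r : ℕ) then g (c : ℕ) else 0) +
      e * (if ((c : ℕ) : ℤ) = (r : ℕ) + 1 then g (c : ℕ) else 0) +
      e * (if ((c : ℕ) : ℤ) = (r : ℕ) - 1 then g (c : ℕ) else 0) +
      α2 * (if ((c : ℕ) : ℤ) = (r : ℕ) + 2 then g (c : ℕ) else 0) +
      α2 * (if ((c : ℕ) : ℤ) = (r : ℕ) - 2 then g (c : ℕ) else 0) := by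
    intro c
    have hpar : ((r : ℕ) % 2 = 0) ↔ (((r : ℕ) : ℤ) % 2 = 0) := by omega
    rw [hP, hxg, ← hd]
    simp only [hpar, ← he]
    clear_value d e g
    split_ifs <;> first | (exfalso; omega) | ring
  have hsum : P.mulVec (x j) r = d * g (r : ℕ) + e * (g ((r : ℕ) + 1) + g ((r : ℕ) - 1)) +
      α2 * ((if ((r : ℕ) : ℤ) + 2 < n then g ((r : ℕ) + 2) else 0) +
        (if 0 ≤ ((r : ℕ) : ℤ) - 2 then g ((r : ℕ) - 2) else 0)) := by
    have hsucc : (if 0 ≤ ((r : ℕ) : ℤ) + 1 ∧ ((r : ℕ) : ℤ) + 1 < n then g ((r : ℕ) + 1) else 0) =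
        g ((r : ℕ) + 1) := by
      split_ifs with hlt
      · rfl
      · rw [show ((r : ℕ) : ℤ) + 1 = n by omega]
        exact (scaledSine_natCast ht).symm
    have hpred : (if 0 ≤ ((r : ℕ) : ℤ) - 1 ∧ ((r : ℕ) : ℤ) - 1 < n then g ((r : ℕ) - 1) else 0) =
        g ((r : ℕ) - 1) := by
      split_ifs with hlt
      · rfl
      · rw [show ((r : ℕ) : ℤ) - 1 = -1 by omega]
        exact (scaledSine_neg_one _ _).symm
    have h₀ : 0 ≤ ((r : ℕ) : ℤ) ∧ ((r : ℕ) : ℤ) < n := by omega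
    have h₁ : (0 ≤ ((r : ℕ) : ℤ) + 2 ∧ ((r : ℕ) : ℤ) + 2 < n) ↔ ((r : ℕ) : ℤ) + 2 < n := by omega
    have h₂ : (0 ≤ ((r : ℕ) : ℤ) - 2 ∧ ((r : ℕ) : ℤ) - 2 < n) ↔ 0 ≤ ((r : ℕ) : ℤ) - 2 := by omega
    simp only [Matrix.mulVec, dotProduct, hentry, Finset.sum_add_distrib, ← Finset.mul_sum,
      sum_fin_ite_intCast_eq, hsucc, hpred, if_pos h₀, h₁, h₂]
    ring
  have hdiag : d * g (r : ℕ) +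
      α2 * ((if ((r : ℕ) : ℤ) + 2 < n then g ((r : ℕ) + 2) else 0) +
        (if 0 ≤ ((r : ℕ) : ℤ) - 2 then g ((r : ℕ) - 2) else 0)) =
      α0 * g (r : ℕ) + α2 * (g ((r : ℕ) + 2) + g ((r : ℕ) - 2)) := by
    have hodd : g (n + 1) = -g (n - 1) := scaledSine_natCast_add_one ht
    have hn0 : g n = 0 := scaledSine_natCast ht
    have hm1 : g (-1) = 0 := scaledSine_neg_one _ _
    have hm2 : g (-2) = -g 0 := scaledSine_neg_two _ _
    clear_value g
    rcases (by omega : (r : ℕ) = 0 ∨ (r : ℕ) = 1 ∨ (2 ≤ (r : ℕ) ∧ (r : ℕ) + 2 < n) ∨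
      (r : ℕ) + 2 = n ∨ (r : ℕ) + 1 = n) with hc | hc | hc | hc | hc
    · rw [hd, if_pos (by omega), if_pos (by omega), if_neg (by omega), hc]
      norm_num [hm2]
      ring
    · rw [hd, if_neg (by omega), if_pos (by omega), if_neg (by omega), hc]
      norm_num [hm1]
    · rw [hd, if_neg (by omega), if_pos (by omega), if_pos (by omega)]
    · rw [hd, if_neg (by omega), if_neg (by omega), if_pos (by omega),
        show ((r : ℕ) : ℤ) + 2 = n by omega, hn0]
    · rw [hd, if_pos (by omega), if_neg (by omega), if_pos (by omega),
        show ((r : ℕ) : ℤ) + 2 = n + 1 by omega, hodd, show ((r : ℕ) : ℤ) = n - 1 by omega]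
      ring
  have hoff := mul_scaledSine_add_one_add_sub_one hα1 hα3 t (r : ℕ)
  have hfar := scaledSine_add_two_add_sub_two √(α3 / α1) t (r : ℕ)
  rw [← hg] at hoff hfar
  rw [← he] at hoff
  rw [hsum, Pi.smul_apply, smul_eq_mul, hxg, hlam,
    show 2 * (j : ℝ) * π * h = 2 * t by rw [htdef]; ring]
  linear_combination hdiag + hoff + α2 * hfar
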